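/- arXiv:2107.14442 — 2 statements merged into one kernel-verified Lean document; each statement's English description precedes it below -/
import Mathlib

section
/- For every matrix X in the set 𝒳, one has ‖X‖²_F ≤ K. -/
open Matrix BigOperators Finset

/-- Frobenius inner product `⟨A,B⟩ = trace (Aᵀ B)`. -/
def frobInner {m k : Type*} [Fintype m] [Fintype k]
    (A B : Matrix m k ℝ) : ℝ := (Aᵀ * B).trace

/-- Squared Frobenius norm `‖A‖²_F = trace (Aᵀ A)`. -/
def frobNormSq {m k : Type*} [Fintype m] [Fintype k]
    (A : Matrix m k ℝ) : ℝ := frobInner A A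

/-- The feasible set `𝒳` of the SDP relaxation: symmetric positive semidefinite
matrices with nonnegative entries, trace `K`, and all row sums equal to `1`. -/
def feasibleSet (n K : ℕ) : Set (Matrix (Fin n) (Fin n) ℝ) :=
  {X | X.PosSemidef ∧ (∀ i j, 0 ≤ X i j) ∧ X.trace = (K : ℝ) ∧ ∀ i, ∑ j, X i j = 1}

/-- For every `X` in the feasible set `𝒳`, `‖X‖²_F ≤ K`. -/
theorem frobNormSq_le_of_mem_feasibleSet {n K : ℕ} (hK : 1 ≤ K) (hKn : K ≤ n)
    (X : Matrix (Fin n) (Fin n) ℝ) (hX : X ∈ feasibleSet n K) :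
    frobNormSq X ≤ (K : ℝ) := by
  obtain ⟨hP, h0, ht, hr⟩ := hX
  have hs : ∀ i j, X j i = X i j := fun i j => by
    have := hP.1.apply i j
    simpa using this
  have hx : ∀ i j, X i j ≤ (X i i + X j j) / 2 := by
    intro i j
    have h := hP.dotProduct_mulVec_nonneg (Pi.single i 1 - Pi.single j 1)
    simp [Matrix.mulVec_sub, sub_dotProduct, dotProduct_sub] at h
    have := hs i j
    linarith
  have hc : ∀ j, ∑ i, X i j = 1 := fun j => by
    rw [← hr j]
    exact Finset.sum_congr rfl fun i _ => hs j i
  have e : frobNormSq X = ∑ i, ∑ j, X i j * X i j := by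
    simp only [frobNormSq, frobInner, Matrix.trace, Matrix.diag, Matrix.mul_apply,
      Matrix.transpose_apply]
    exact Finset.sum_comm
  have e1 : ∑ i, ∑ j, X i j * X i i = K := by
    simp only [← Finset.sum_mul, hr, one_mul]
    exact ht
  have e2 : ∑ i, ∑ j, X i j * X j j = K := by
    rw [Finset.sum_comm]
    simp only [← Finset.sum_mul, hc, one_mul]
    exact ht
  rw [e]
  calc ∑ i, ∑ j, X i j * X i j ≤ ∑ i, ∑ j, (X i j * X i i + X i j * X j j) / 2 := by
        refine Finset.sum_le_sum fun i _ => Finset.sum_le_sum fun j _ => ?_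
        have := mul_le_mul_of_nonneg_left (hx i j) (h0 i j)
        linarith
    _ = K := by
        simp only [← Finset.sum_div, Finset.sum_add_distrib]
        rw [e1, e2]
        ring
end

section
/- Let C be a K-clustering of [n] and let D ∈ ℝ^{n×n} be the squared distance matrix of data x_1,…,x_n ∈ ℝ^d, and let κ(C) = inf{⟨X(C),X'⟩ : X' ∈ 𝒳, ⟨D,X'⟩ ≤ ⟨D,X(C)⟩}. Then every K-clustering C' of [n] with Loss_Km(D,C') ≤ Loss_Km(D,C) satisfies ⟨X(C), X(C')⟩ ≥ κ(C), and hence (1/2)·‖X(C) − X(C')‖²_F ≤ K − κ(C). -/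
open Matrix BigOperators Finset

def clusterSize {n K : ℕ} (c : Fin n → Fin K) (k : Fin K) : ℕ :=
  (Finset.univ.filter fun i => c i = k).card

noncomputable def clusterMatrix {n K : ℕ} (c : Fin n → Fin K) :
    Matrix (Fin n) (Fin n) ℝ :=
  fun i j => if c i = c j then ((clusterSize c (c i) : ℝ))⁻¹ else 0

noncomputable def sqDistMatrix {n d : ℕ} (x : Fin n → EuclideanSpace ℝ (Fin d)) :
    Matrix (Fin n) (Fin n) ℝ :=
  fun i j => ‖x i - x j‖ ^ 2

noncomputable def centroid {n K d : ℕ} (x : Fin n → EuclideanSpace ℝ (Fin d))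
    (c : Fin n → Fin K) (k : Fin K) : EuclideanSpace ℝ (Fin d) :=
  ((clusterSize c k : ℝ))⁻¹ • ∑ i ∈ Finset.univ.filter (fun i => c i = k), x i

noncomputable def kmeansLoss {n K d : ℕ} (x : Fin n → EuclideanSpace ℝ (Fin d))
    (c : Fin n → Fin K) : ℝ :=
  (n : ℝ)⁻¹ * ∑ k : Fin K, ∑ i ∈ Finset.univ.filter (fun i => c i = k),
    ‖x i - centroid x c k‖ ^ 2


theorem frobInner_eq_sum {m k : Type*} [Fintype m] [Fintype k] (A B : Matrix m k ℝ) :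
    frobInner A B = ∑ i, ∑ j, A i j * B i j := by
  simp only [frobInner, Matrix.trace, Matrix.diag, Matrix.mul_apply, Matrix.transpose_apply]
  exact Finset.sum_comm

theorem clusterSize_pos' {n K : ℕ} (c : Fin n → Fin K) (i : Fin n) :
    (0 : ℝ) < clusterSize c (c i) := by
  have : 0 < clusterSize c (c i) := Finset.card_pos.mpr ⟨i, by simp⟩
  exact_mod_cast this

theorem clusterMatrix_nonneg {n K : ℕ} (c : Fin n → Fin K) (i j : Fin n) :
    0 ≤ clusterMatrix c i j := by
  unfold clusterMatrix
  split_ifs <;> positivity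

theorem clusterMatrix_symm {n K : ℕ} (c : Fin n → Fin K) (i j : Fin n) :
    clusterMatrix c i j = clusterMatrix c j i := by
  unfold clusterMatrix
  by_cases h : c i = c j
  · simp [h]
  · simp [h, Ne.symm h]

theorem clusterMatrix_sum {n K : ℕ} (c : Fin n → Fin K) (i : Fin n) (f : Fin n → ℝ) :
    ∑ j, clusterMatrix c i j * f j =
      (clusterSize c (c i) : ℝ)⁻¹ * ∑ j ∈ Finset.univ.filter (fun j => c j = c i), f j := by
  rw [Finset.mul_sum, Finset.sum_filter]
  refine Finset.sum_congr rfl fun j _ => ?_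
  unfold clusterMatrix
  by_cases h : c i = c j
  · simp [h]
  · simp [h, Ne.symm h]

theorem clusterMatrix_row {n K : ℕ} (c : Fin n → Fin K) (i : Fin n) :
    ∑ j, clusterMatrix c i j = 1 := by
  have h := clusterMatrix_sum c i (fun _ => 1)
  simp only [mul_one, Finset.sum_const, nsmul_eq_mul] at h
  rw [h]
  exact inv_mul_cancel₀ (clusterSize_pos' c i).ne'

theorem clusterMatrix_transpose {n K : ℕ} (c : Fin n → Fin K) :
    (clusterMatrix c)ᵀ = clusterMatrix c := by
  ext i j
  exact clusterMatrix_symm c j i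

theorem clusterMatrix_idem {n K : ℕ} (c : Fin n → Fin K) :
    clusterMatrix c * clusterMatrix c = clusterMatrix c := by
  ext i k
  rw [Matrix.mul_apply, clusterMatrix_sum]
  have : ∀ j ∈ Finset.univ.filter (fun j => c j = c i),
      clusterMatrix c j k = clusterMatrix c i k := by
    intro j hj
    have hj : c j = c i := by simpa using hj
    simp [clusterMatrix, hj]
  rw [Finset.sum_congr rfl this, Finset.sum_const, nsmul_eq_mul, ← mul_assoc]
  have h := inv_mul_cancel₀ (clusterSize_pos' c i).ne'
  unfold clusterSize at h ⊢
  rw [h, one_mul]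

theorem clusterMatrix_trace {n K : ℕ} (c : Fin n → Fin K) (hc : Function.Surjective c) :
    (clusterMatrix c).trace = K := by
  have h1 : (clusterMatrix c).trace = ∑ i, (clusterSize c (c i) : ℝ)⁻¹ := by
    simp [Matrix.trace, clusterMatrix]
  rw [h1, ← Finset.sum_fiberwise (s := Finset.univ) (g := c)]
  have : ∀ k ∈ (Finset.univ : Finset (Fin K)),
      ∑ i ∈ Finset.univ.filter (fun i => c i = k), (clusterSize c (c i) : ℝ)⁻¹ = 1 := by
    intro k _
    obtain ⟨i, rfl⟩ := hc k
    rw [Finset.sum_congr rfl (g := fun _ => (clusterSize c (c i) : ℝ)⁻¹)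
      (fun j hj => by
        have hj : c j = c i := by simpa using hj
        rw [hj]), Finset.sum_const, nsmul_eq_mul]
    exact mul_inv_cancel₀ (clusterSize_pos' c i).ne'
  rw [Finset.sum_congr rfl this]
  simp

theorem clusterMatrix_feasible {n K : ℕ} (c : Fin n → Fin K) (hc : Function.Surjective c) :
    clusterMatrix c ∈ feasibleSet n K := by
  refine ⟨?_, clusterMatrix_nonneg c, clusterMatrix_trace c hc, clusterMatrix_row c⟩
  have h := Matrix.posSemidef_conjTranspose_mul_self (clusterMatrix c)
  rwa [Matrix.conjTranspose_eq_transpose_of_trivial, clusterMatrix_transpose,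
    clusterMatrix_idem] at h

theorem frobInner_self_cluster {n K : ℕ} (c : Fin n → Fin K) (hc : Function.Surjective c) :
    frobInner (clusterMatrix c) (clusterMatrix c) = K := by
  rw [frobInner, clusterMatrix_transpose, clusterMatrix_idem, clusterMatrix_trace c hc]

theorem sum_sq_dist {ι E : Type*} [NormedAddCommGroup E] [InnerProductSpace ℝ E]
    (s : Finset ι) (y : ι → E) (μ : E) (hμ : ∑ i ∈ s, (y i - μ) = 0) :
    ∑ i ∈ s, ∑ j ∈ s, ‖y i - y j‖ ^ 2 = 2 * (s.card : ℝ) * ∑ i ∈ s, ‖y i - μ‖ ^ 2 := by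
  have h : ∀ i j, ‖y i - y j‖ ^ 2 =
      ‖y i - μ‖ ^ 2 - 2 * inner ℝ (y i - μ) (y j - μ) + ‖y j - μ‖ ^ 2 := by
    intro i j
    rw [← norm_sub_sq_real, sub_sub_sub_cancel_right]
  simp only [h, Finset.sum_add_distrib, Finset.sum_sub_distrib, ← Finset.mul_sum, ← inner_sum, hμ,
    inner_zero_right, Finset.sum_const, nsmul_eq_mul]
  ring

theorem frobInner_dist {n K d : ℕ} (x : Fin n → EuclideanSpace ℝ (Fin d))
    (c : Fin n → Fin K) :
    frobInner (sqDistMatrix x) (clusterMatrix c) =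
      2 * ∑ k : Fin K, ∑ i ∈ Finset.univ.filter (fun i => c i = k),
        ‖x i - centroid x c k‖ ^ 2 := by
  rw [frobInner_eq_sum, ← Finset.sum_fiberwise (s := Finset.univ) (g := c), Finset.mul_sum]
  refine Finset.sum_congr rfl fun k _ => ?_
  have h1 : ∀ i ∈ Finset.univ.filter (fun i => c i = k),
      ∑ j, sqDistMatrix x i j * clusterMatrix c i j = (clusterSize c k : ℝ)⁻¹ *
        ∑ j ∈ Finset.univ.filter (fun j => c j = k), ‖x i - x j‖ ^ 2 := by
    intro i hi
    have hi : c i = k := by simpa using hi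
    subst hi
    rw [← clusterMatrix_sum]
    exact Finset.sum_congr rfl fun j _ => mul_comm _ _
  rw [Finset.sum_congr rfl h1, ← Finset.mul_sum]
  by_cases hk : ∃ i, c i = k
  · obtain ⟨i, rfl⟩ := hk
    have hp := (clusterSize_pos' c i).ne'
    rw [sum_sq_dist _ x (centroid x c (c i))]
    · change (clusterSize c (c i) : ℝ)⁻¹ * (2 * (clusterSize c (c i) : ℝ) * _) = _
      field_simp
    · rw [Finset.sum_sub_distrib, Finset.sum_const, ← Nat.cast_smul_eq_nsmul ℝ]
      change _ - (clusterSize c (c i) : ℝ) • centroid x c (c i) = 0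
      rw [_root_.centroid, smul_inv_smul₀ hp, sub_self]
  · have : Finset.univ.filter (fun i => c i = k) = ∅ := by
      ext i
      simpa using fun h => hk ⟨i, h⟩
    simp [this]

/-- Every clustering `C'` at least as good as `C` for the K-means loss has
`⟨X(C),X(C')⟩ ≥ κ(C)`, hence `(1/2)‖X(C) − X(C')‖²_F ≤ K − κ(C)`. -/
theorem kmeans_sublevel_inner_bound {n K d : ℕ}
    (x : Fin n → EuclideanSpace ℝ (Fin d))
    (c : Fin n → Fin K) (hc : Function.Surjective c)
    (κ : ℝ)
    (hκ : κ = sInf {r | ∃ X' ∈ feasibleSet n K,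
      frobInner (sqDistMatrix x) X' ≤ frobInner (sqDistMatrix x) (clusterMatrix c) ∧
      r = frobInner (clusterMatrix c) X'}) :
    ∀ c' : Fin n → Fin K, Function.Surjective c' →
      kmeansLoss x c' ≤ kmeansLoss x c →
      κ ≤ frobInner (clusterMatrix c) (clusterMatrix c') ∧
      (1 / 2) * frobNormSq (clusterMatrix c - clusterMatrix c') ≤ (K : ℝ) - κ := by
  intro c' hc' hl
  have hD : frobInner (sqDistMatrix x) (clusterMatrix c') ≤
      frobInner (sqDistMatrix x) (clusterMatrix c) := by
    rcases Nat.eq_zero_or_pos n with rfl | hn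
    · simp [frobInner_eq_sum]
    · rw [frobInner_dist, frobInner_dist]
      have hn' : (0 : ℝ) < (n : ℝ)⁻¹ := by positivity
      have := le_of_mul_le_mul_left hl hn'
      linarith
  have h1 : κ ≤ frobInner (clusterMatrix c) (clusterMatrix c') := by
    rw [hκ]
    refine csInf_le ⟨0, ?_⟩ ⟨_, clusterMatrix_feasible c' hc', hD, rfl⟩
    rintro r ⟨X, hX, -, rfl⟩
    rw [frobInner_eq_sum]
    exact Finset.sum_nonneg fun i _ => Finset.sum_nonneg fun j _ =>
      mul_nonneg (clusterMatrix_nonneg c i j) (hX.2.1 i j)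
  refine ⟨h1, ?_⟩
  have h2 : frobNormSq (clusterMatrix c - clusterMatrix c') =
      frobInner (clusterMatrix c) (clusterMatrix c)
        - 2 * frobInner (clusterMatrix c) (clusterMatrix c')
        + frobInner (clusterMatrix c') (clusterMatrix c') := by
    simp only [frobNormSq, frobInner_eq_sum, Matrix.sub_apply, Finset.mul_sum,
      ← Finset.sum_add_distrib, ← Finset.sum_sub_distrib]
    exact Finset.sum_congr rfl fun i _ => Finset.sum_congr rfl fun j _ => by ring
  rw [h2, frobInner_self_cluster c hc, frobInner_self_cluster c' hc']
  linarith
end
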